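/- Let T be a closed densely defined operator on a complex Hilbert space H. Then T is m-accretive with closed range if and only if its Moore-Penrose inverse T† is bounded and accretive. -/

import Mathlib

open scoped ComplexInnerProductSpace
noncomputable section

variable {H : Type*} [NormedAddCommGroup H] [InnerProductSpace ℂ H] [CompleteSpace H]

/-- The range of a partially defined operator, as a submodule of `H`. -/
def pRange (T : H →ₗ.[ℂ] H) : Submodule ℂ H := LinearMap.range T.toFun

/-- The kernel of a partially defined operator, as a submodule of `H`. -/
def pKer (T : H →ₗ.[ℂ] H) : Submodule ℂ H := (LinearMap.ker T.toFun).map T.domain.subtype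

/-- An operator `T` is accretive if `Re ⟨T x, x⟩ ≥ 0` for all `x` in its domain. -/
def PAccretive (T : H →ₗ.[ℂ] H) : Prop := ∀ x : T.domain, 0 ≤ (⟪(x : H), T x⟫).re

/-- `T` is m-accretive: accretive, densely defined, closed, and `R(μ + T) = H` for all `μ > 0`. -/
def MAccretive (T : H →ₗ.[ℂ] H) : Prop :=
  PAccretive T ∧ Dense (T.domain : Set H) ∧ IsClosed (T.graph : Set (H × H)) ∧
    ∀ μ : ℝ, 0 < μ → ∀ y : H, ∃ x : T.domain, (μ : ℂ) • (x : H) + T x = y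

/-- `T` is sectorial with vertex `0` and semiangle `ω` (ω-accretive):
`W(T) ⊆ {z : |arg z| ≤ ω}`. -/
def SectorialP (T : H →ₗ.[ℂ] H) (ω : ℝ) : Prop :=
  ∀ x : T.domain, ‖(x : H)‖ = 1 → |(⟪(x : H), T x⟫).arg| ≤ ω

/-- `y` is the orthogonal projection of `x` onto the closure of `M`. -/
def IsProjOnto (M : Submodule ℂ H) (x y : H) : Prop :=
  y ∈ M.topologicalClosure ∧ x - y ∈ Mᗮ

/-- `Td` is the Moore-Penrose inverse of `T`: a closed densely defined operator with
domain `R(T) ⊕ R(T)ᗮ` such that `T Td T = T` on `D(T)`, `Td T Td = Td` on `D(Td)`,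
`T Td = P_{cl R(T)}` on `D(Td)` and `Td T = P_{N(T)ᗮ}` on `D(T)`. -/
structure IsMoorePenroseInverse (T Td : H →ₗ.[ℂ] H) : Prop where
  closed' : IsClosed (Td.graph : Set (H × H))
  dense' : Dense (Td.domain : Set H)
  domain_eq : Td.domain = pRange T ⊔ (pRange T)ᗮ
  tdt : ∀ x : T.domain, ∃ (h1 : T x ∈ Td.domain) (h2 : Td ⟨T x, h1⟩ ∈ T.domain),
    T ⟨Td ⟨T x, h1⟩, h2⟩ = T x
  dtd : ∀ x : Td.domain, ∃ (h1 : Td x ∈ T.domain) (h2 : T ⟨Td x, h1⟩ ∈ Td.domain),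
    Td ⟨T ⟨Td x, h1⟩, h2⟩ = Td x
  proj_range : ∀ x : Td.domain, ∃ h1 : Td x ∈ T.domain,
    IsProjOnto (pRange T) (x : H) (T ⟨Td x, h1⟩)
  proj_ker : ∀ x : T.domain, ∃ h1 : T x ∈ Td.domain,
    IsProjOnto ((pKer T)ᗮ) (x : H) (Td ⟨T x, h1⟩)

/-- A bounded everywhere-defined operator viewed as a partially defined operator. -/
def clmToPMap (S : H →L[ℂ] H) : H →ₗ.[ℂ] H := S.toLinearMap.toPMap ⊤

/-- A partially defined operator is bounded if it is bounded on its domain. -/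
def BoundedPMap (T : H →ₗ.[ℂ] H) : Prop := ∃ C : ℝ, ∀ x : T.domain, ‖T x‖ ≤ C * ‖(x : H)‖

/-- `T Td = Td T` on `D(T)`. -/
def CommutesOnDomain (T Td : H →ₗ.[ℂ] H) : Prop :=
  ∀ x : T.domain, ∃ (h1 : (x : H) ∈ Td.domain) (h2 : Td ⟨(x : H), h1⟩ ∈ T.domain)
    (h3 : T x ∈ Td.domain), T ⟨Td ⟨(x : H), h1⟩, h2⟩ = Td ⟨T x, h3⟩

/-- `T` is an EP operator: its Moore-Penrose inverse is bounded and `T T† = T† T` on `D(T)`. -/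
def IsEPPMap (T : H →ₗ.[ℂ] H) : Prop :=
  ∃ Td : H →ₗ.[ℂ] H, IsMoorePenroseInverse T Td ∧ BoundedPMap Td ∧ CommutesOnDomain T Td

/-- The sum `T + S` of a partially defined operator and a bounded operator, with domain `D(T)`. -/
def addB (T : H →ₗ.[ℂ] H) (S : H →L[ℂ] H) : H →ₗ.[ℂ] H :=
  ⟨T.domain, T.toFun + S.toLinearMap.comp T.domain.subtype⟩

/-- The sum of two partially defined operators, with domain `D(A) ∩ D(B)`. -/
def pAdd (A B : H →ₗ.[ℂ] H) : H →ₗ.[ℂ] H :=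
  ⟨A.domain ⊓ B.domain,
    A.toFun.comp (Submodule.inclusion inf_le_left) +
      B.toFun.comp (Submodule.inclusion inf_le_right)⟩

/-- The difference of two partially defined operators, with domain `D(A) ∩ D(B)`. -/
def pSub (A B : H →ₗ.[ℂ] H) : H →ₗ.[ℂ] H :=
  ⟨A.domain ⊓ B.domain,
    A.toFun.comp (Submodule.inclusion inf_le_left) -
      B.toFun.comp (Submodule.inclusion inf_le_right)⟩

/-- The operator `-A - r` on `D(A)`. -/
def negShift (A : H →ₗ.[ℂ] H) (r : ℝ) : H →ₗ.[ℂ] H :=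
  ⟨A.domain, -A.toFun - (r : ℂ) • A.domain.subtype⟩

/-- The composition `B ∘ A` of a bounded operator with a partially defined one. -/
def compB (B : H →L[ℂ] H) (A : H →ₗ.[ℂ] H) : H →ₗ.[ℂ] H :=
  ⟨A.domain, B.toLinearMap.comp A.toFun⟩

/-- `T2` is the square `T ∘ T` of `T`, with domain `{x ∈ D(T) : T x ∈ D(T)}`. -/
def IsSquareOf (T T2 : H →ₗ.[ℂ] H) : Prop :=
  (∀ x : T2.domain, ∃ (h1 : (x : H) ∈ T.domain) (h2 : T ⟨(x : H), h1⟩ ∈ T.domain),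
      T2 x = T ⟨T ⟨(x : H), h1⟩, h2⟩) ∧
  ∀ x : H, x ∈ T2.domain ↔ ∃ h : x ∈ T.domain, T ⟨x, h⟩ ∈ T.domain

/-- The reduced minimum modulus `γ(T) = inf {‖T x‖ : x ∈ N(T)ᗮ ∩ D(T), ‖x‖ = 1}`. -/
def gammaP (T : H →ₗ.[ℂ] H) : ℝ :=
  sInf {r | ∃ x : T.domain, (x : H) ∈ (pKer T)ᗮ ∧ ‖(x : H)‖ = 1 ∧ r = ‖T x‖}

/-- The spectrum of a partially defined operator: the complement of the set of `μ` for which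
`μ - A` has an everywhere-defined bounded inverse. -/
def pSpectrum (A : H →ₗ.[ℂ] H) : Set ℂ :=
  {μ | ¬ ∃ B : H →L[ℂ] H, (∀ x : A.domain, B (μ • (x : H) - A x) = (x : H)) ∧
        ∀ y : H, ∃ h : B y ∈ A.domain, μ • B y - A ⟨B y, h⟩ = y}

/-- The numerical radius of a partially defined operator. -/
def pNumRad (A : H →ₗ.[ℂ] H) : ℝ :=
  sSup {r | ∃ x : A.domain, ‖(x : H)‖ = 1 ∧ r = ‖⟪(x : H), A x⟫‖}

/-- `B` is an everywhere-defined bounded inverse of the partially defined operator `A`. -/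
def IsBoundedInverseOf (A : H →ₗ.[ℂ] H) (B : H →L[ℂ] H) : Prop :=
  (∀ x : A.domain, B (A x) = (x : H)) ∧ ∀ y : H, ∃ h : B y ∈ A.domain, A ⟨B y, h⟩ = y

/-- The real part `(T + T*)/2` of a bounded operator. -/
def reOp (T : H →L[ℂ] H) : H →L[ℂ] H := (2 : ℂ)⁻¹ • (T + ContinuousLinearMap.adjoint T)

/-- The imaginary part `(T - T*)/(2i)` of a bounded operator. -/
def imOp (T : H →L[ℂ] H) : H →L[ℂ] H :=
  (2 * Complex.I)⁻¹ • (T - ContinuousLinearMap.adjoint T)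

/-- A bounded operator is accretive if `Re ⟨T x, x⟩ ≥ 0` for all `x`. -/
def CAccretive (T : H →L[ℂ] H) : Prop := ∀ x : H, 0 ≤ (⟪x, T x⟫).re

/-- A bounded operator is sectorial with vertex `0` and semiangle `ω` if
`W(T) ⊆ {z : |arg z| ≤ ω}`. -/
def Sectorial (T : H →L[ℂ] H) (ω : ℝ) : Prop :=
  ∀ x : H, ‖x‖ = 1 → |(⟪x, T x⟫).arg| ≤ ω

/-- The numerical radius `w(T) = sup {|⟨T x, x⟩| : ‖x‖ = 1}` of a bounded operator. -/
def numRad (T : H →L[ℂ] H) : ℝ := sSup {r | ∃ x : H, ‖x‖ = 1 ∧ r = ‖⟪x, T x⟫‖}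

theorem mem_pKer {T : H →ₗ.[ℂ] H} {x : H} :
    x ∈ pKer T ↔ ∃ h : x ∈ T.domain, T ⟨x, h⟩ = 0 := by
  simp only [pKer, Submodule.mem_map, LinearMap.mem_ker, Submodule.subtype_apply, Subtype.exists,
    exists_and_right, exists_eq_right]
  rfl

theorem apply_mem_pRange (T : H →ₗ.[ℂ] H) (x : T.domain) : T x ∈ pRange T :=
  ⟨x, rfl⟩

theorem isClosed_pKer {T : H →ₗ.[ℂ] H} (hT : IsClosed (T.graph : Set (H × H))) :
    IsClosed (pKer T : Set H) := by
  have h : (pKer T : Set H) = (fun x : H => (x, (0 : H))) ⁻¹' (T.graph : Set (H × H)) := by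
    ext x
    simp [mem_pKer]
  rw [h]
  exact hT.preimage (by fun_prop)

/-- If the real part of the form of an accretive operator vanishes at `x`, then `x` lies in the
kernel of its symmetric part. -/
theorem PAccretive.inner_add_inner_eq_zero {A : H →ₗ.[ℂ] H} (hA : PAccretive A) {x : A.domain}
    (hx : (⟪(x : H), A x⟫).re = 0) (y : A.domain) : ⟪(x : H), A y⟫ + ⟪A x, (y : H)⟫ = 0 := by
  set a : ℂ := ⟪(x : H), A y⟫ + ⟪A x, (y : H)⟫ with ha
  set c : ℝ := (⟪(y : H), A y⟫).re with hc
  have hc0 : 0 ≤ c := hA y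
  have key : ∀ s : ℂ, 0 ≤ ‖s‖ ^ 2 * c + (s * a).re := by
    intro s
    have h := hA (x + s • y)
    rw [LinearPMap.map_add, LinearPMap.map_smul, Submodule.coe_add, Submodule.coe_smul,
      inner_add_left, inner_add_right, inner_add_right, inner_smul_left, inner_smul_left,
      inner_smul_right, inner_smul_right, ← inner_conj_symm (y : H) (A x), ← mul_assoc,
      ← Complex.normSq_eq_conj_mul_self, ← map_mul, Complex.add_re, Complex.add_re,
      Complex.add_re, Complex.conj_re, Complex.re_ofReal_mul, Complex.normSq_eq_norm_sq, hx] at h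
    rw [ha, mul_add, Complex.add_re]
    linarith
  have h := key (-((1 + c)⁻¹ : ℝ) * (starRingEnd ℂ) a)
  have hpos : 0 < 1 + c := by linarith
  rw [mul_assoc, ← Complex.normSq_eq_conj_mul_self, ← Complex.ofReal_neg, ← Complex.ofReal_mul,
    Complex.ofReal_re, norm_mul, RCLike.norm_conj, Complex.norm_real, norm_neg, mul_pow,
    Complex.normSq_eq_norm_sq, Real.norm_eq_abs, sq_abs] at h
  have h2 : ((1 + c)⁻¹ ^ 2 * ‖a‖ ^ 2 * c + -(1 + c)⁻¹ * ‖a‖ ^ 2) * (1 + c) ^ 2 = -‖a‖ ^ 2 := by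
    field_simp
    ring
  have h3 : 0 ≤ -‖a‖ ^ 2 := h2 ▸ mul_nonneg h (sq_nonneg _)
  have h4 : ‖a‖ ^ 2 = 0 := le_antisymm (by linarith) (sq_nonneg _)
  simpa using h4

/-- The kernel of an accretive operator is orthogonal to its range. -/
theorem PAccretive.inner_apply_eq_zero {A : H →ₗ.[ℂ] H} (hA : PAccretive A) {x : A.domain}
    (hx : A x = 0) (y : A.domain) : ⟪(x : H), A y⟫ = 0 := by
  simpa [hx] using hA.inner_add_inner_eq_zero (x := x) (by simp [hx]) y

theorem PAccretive.pKer_le {A : H →ₗ.[ℂ] H} (hA : PAccretive A) : pKer A ≤ (pRange A)ᗮ := by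
  intro x hx
  obtain ⟨h, hx0⟩ := mem_pKer.1 hx
  rw [Submodule.mem_orthogonal']
  rintro _ ⟨y, rfl⟩
  exact hA.inner_apply_eq_zero hx0 y

theorem MAccretive.orthogonal_pRange_le {A : H →ₗ.[ℂ] H} (hA : MAccretive A) :
    (pRange A)ᗮ ≤ pKer A := by
  intro y hy
  obtain ⟨x, hx⟩ := hA.2.2.2 1 one_pos y
  rw [Complex.ofReal_one, one_smul] at hx
  have h := (Submodule.mem_orthogonal' _ _).1 hy _ (apply_mem_pRange A x)
  rw [← hx, inner_add_left] at h
  have h1 := congrArg Complex.re h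
  have h2 : (⟪A x, A x⟫).re = ‖A x‖ ^ 2 := inner_self_eq_norm_sq (𝕜 := ℂ) (A x)
  rw [Complex.add_re, h2, Complex.zero_re] at h1
  have h3 : ‖A x‖ ^ 2 = 0 := le_antisymm (by linarith [hA.1 x]) (sq_nonneg _)
  have h4 : A x = 0 := by simpa using h3
  rw [h4, add_zero] at hx
  exact mem_pKer.2 ⟨hx ▸ x.2, by subst hx; exact h4⟩

/-- A closed bounded densely defined operator is everywhere defined. -/
theorem BoundedPMap.domain_eq_top {A : H →ₗ.[ℂ] H} (hA : BoundedPMap A)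
    (hclosed : IsClosed (A.graph : Set (H × H))) (hdense : Dense (A.domain : Set H)) :
    A.domain = ⊤ := by
  obtain ⟨C, hC⟩ := hA
  rw [Submodule.eq_top_iff']
  intro x
  obtain ⟨u, hu, hux⟩ := mem_closure_iff_seq_limit.1 (hdense x)
  let v : ℕ → A.domain := fun n => ⟨u n, hu n⟩
  have hv : CauchySeq v := by
    have h := hux.cauchySeq
    exact isUniformEmbedding_subtype_val.isUniformInducing.cauchy_map_iff.1 h
  have hAv : CauchySeq (fun n => A (v n)) :=
    hv.map (A.toFun.mkContinuous C hC).uniformContinuous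
  obtain ⟨y, hy⟩ := cauchySeq_tendsto_of_complete hAv
  have hmem : (x, y) ∈ (A.graph : Set (H × H)) :=
    hclosed.mem_of_tendsto (hux.prodMk_nhds hy)
      (Filter.Eventually.of_forall fun n => A.mem_graph (v n))
  exact LinearPMap.mem_domain_of_mem_graph hmem

/-- The closed graph theorem for everywhere defined partial operators. -/
theorem exists_clm_of_isClosed_graph {A : H →ₗ.[ℂ] H}
    (hclosed : IsClosed (A.graph : Set (H × H))) (htop : A.domain = ⊤) :
    ∃ S : H →L[ℂ] H, ∀ x : A.domain, A x = S x := by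
  have hmem : ∀ x : H, (LinearMap.id : H →ₗ[ℂ] H) x ∈ A.domain := fun x => htop ▸ trivial
  let S : H →ₗ[ℂ] H := A.toFun.comp (LinearMap.id.codRestrict A.domain hmem)
  have hS : S.graph = A.graph := by
    ext ⟨x, y⟩
    rw [LinearMap.mem_graph_iff, LinearPMap.mem_graph_iff]
    constructor
    · intro hy
      exact ⟨⟨x, hmem x⟩, rfl, hy.symm⟩
    · rintro ⟨z, rfl, rfl⟩
      rfl
  exact ⟨⟨S, S.continuous_of_isClosed_graph (hS ▸ hclosed)⟩, fun x => rfl⟩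

/-- `1 + μ S` is onto for an accretive bounded operator `S` and `μ ≥ 0`. -/
theorem CAccretive.exists_add_smul_eq {S : H →L[ℂ] H} (hS : CAccretive S) {μ : ℝ} (hμ : 0 ≤ μ)
    (y : H) : ∃ w, w + (μ : ℂ) • S w = y := by
  have hu : IsUnit (1 + (μ : ℂ) • S) := by
    refine ContinuousLinearMap.isUnit_of_forall_le_norm_inner_map _ (c := 1) one_pos fun x => ?_
    rw [norm_inner_symm, NNReal.coe_one, mul_one]
    refine le_trans ?_ (Complex.re_le_norm _)
    have h2 : (⟪x, x⟫).re = ‖x‖ ^ 2 := inner_self_eq_norm_sq (𝕜 := ℂ) x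
    have h3 : ((1 : H →L[ℂ] H) + (μ : ℂ) • S) x = x + (μ : ℂ) • S x := rfl
    rw [h3, inner_add_right, inner_smul_right, Complex.add_re, Complex.re_ofReal_mul, h2]
    linarith [mul_nonneg hμ (hS x)]
  exact (ContinuousLinearMap.isUnit_iff_bijective.1 hu).2 y

theorem Submodule.eq_zero_of_mem_closure_of_mem_orthogonal {M : Submodule ℂ H} {x : H}
    (hx : x ∈ M.topologicalClosure) (hx' : x ∈ Mᗮ) : x = 0 := by
  rw [← Submodule.orthogonal_closure] at hx'
  exact inner_self_eq_zero.1 ((Submodule.mem_orthogonal' _ _).1 hx' x hx)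

namespace IsMoorePenroseInverse

variable {T Td : H →ₗ.[ℂ] H}

theorem apply_mem_orthogonal_pKer (h : IsMoorePenroseInverse T Td) (x : Td.domain) :
    Td x ∈ (pKer T)ᗮ := by
  obtain ⟨h1, h2, hx⟩ := h.dtd x
  obtain ⟨_, hp, -⟩ := h.proj_ker ⟨Td x, h1⟩
  rwa [hx, (Submodule.isClosed_orthogonal _).submodule_topologicalClosure_eq] at hp

theorem domain_eq_top (h : IsMoorePenroseInverse T Td) (hR : IsClosed (pRange T : Set H)) :
    Td.domain = ⊤ := by
  have : CompleteSpace (pRange T) := hR.completeSpace_coe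
  rw [h.domain_eq, Submodule.sup_orthogonal_of_hasOrthogonalProjection]

theorem boundedPMap (h : IsMoorePenroseInverse T Td) (hR : IsClosed (pRange T : Set H)) :
    BoundedPMap Td := by
  obtain ⟨S, hS⟩ := exists_clm_of_isClosed_graph h.closed' (h.domain_eq_top hR)
  exact ⟨‖S‖, fun x => hS x ▸ S.le_opNorm x⟩

theorem pAccretive (h : IsMoorePenroseInverse T Td) (hT : MAccretive T) : PAccretive Td := by
  intro x
  obtain ⟨h1, -, ho⟩ := h.proj_range x
  have h0 := (Submodule.mem_orthogonal _ _).1 (h.apply_mem_orthogonal_pKer x) _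
    (hT.orthogonal_pRange_le ho)
  rw [inner_sub_left, sub_eq_zero] at h0
  rw [h0, ← inner_conj_symm, Complex.conj_re]
  exact hT.1 ⟨Td x, h1⟩

theorem isClosed_pRange (h : IsMoorePenroseInverse T Td) (htop : Td.domain = ⊤) :
    IsClosed (pRange T : Set H) := by
  refine isClosed_of_closure_subset fun x hx => ?_
  obtain ⟨h1, hc, ho⟩ := h.proj_range ⟨x, htop ▸ trivial⟩
  have hx0 := Submodule.eq_zero_of_mem_closure_of_mem_orthogonal
    (Submodule.sub_mem _ (show x ∈ (pRange T).topologicalClosure from hx) hc) ho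
  rw [sub_eq_zero] at hx0
  have hm := apply_mem_pRange T ⟨_, h1⟩
  rwa [← hx0] at hm

theorem orthogonal_pRange_le_pKer_inverse (h : IsMoorePenroseInverse T Td) :
    (pRange T)ᗮ ≤ pKer Td := by
  intro q hq
  have hqd : q ∈ Td.domain := h.domain_eq ▸ Submodule.mem_sup_right hq
  obtain ⟨h1, hc, ho⟩ := h.proj_range ⟨q, hqd⟩
  have h0 : T ⟨Td ⟨q, hqd⟩, h1⟩ = 0 := by
    refine Submodule.eq_zero_of_mem_closure_of_mem_orthogonal hc ?_
    simpa using Submodule.sub_mem _ hq ho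
  refine mem_pKer.2 ⟨hqd, ?_⟩
  obtain ⟨h1', h2', hd⟩ := h.dtd ⟨q, hqd⟩
  rw [← hd, show (⟨T ⟨Td ⟨q, hqd⟩, h1'⟩, h2'⟩ : Td.domain) = 0 from Subtype.ext h0,
    LinearPMap.map_zero]

theorem pKer_le_orthogonal_pRange (h : IsMoorePenroseInverse T Td) (htop : Td.domain = ⊤)
    (hacc : PAccretive Td) : pKer T ≤ (pRange T)ᗮ := by
  intro n hn
  let n' : Td.domain := ⟨n, htop ▸ trivial⟩
  have horth : ∀ y : Td.domain, ⟪n, Td y⟫ = 0 := fun y =>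
    (Submodule.mem_orthogonal _ _).1 (h.apply_mem_orthogonal_pKer y) _ hn
  have hz := hacc.inner_add_inner_eq_zero (x := n') (by simp [n', horth])
    ⟨Td n', htop ▸ trivial⟩
  rw [horth, zero_add] at hz
  have hz' : Td n' = 0 := inner_self_eq_zero.1 hz
  obtain ⟨h1, -, ho⟩ := h.proj_range n'
  rwa [show (⟨Td n', h1⟩ : T.domain) = 0 from Subtype.ext hz', LinearPMap.map_zero,
    sub_zero] at ho

theorem orthogonal_pRange_le_pKer (h : IsMoorePenroseInverse T Td)
    (hclosed : IsClosed (T.graph : Set (H × H))) (hdense : Dense (T.domain : Set H))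
    (hacc : PAccretive Td) : (pRange T)ᗮ ≤ pKer T := by
  intro q hq
  have : CompleteSpace (pKer T) := (isClosed_pKer hclosed).completeSpace_coe
  have hq' := hacc.pKer_le (h.orthogonal_pRange_le_pKer_inverse hq)
  have hP : (pKer T)ᗮ.starProjection q = 0 := by
    refine hdense.eq_zero_of_inner_left ℂ fun x hx => ?_
    obtain ⟨h1, hc, ho⟩ := h.proj_ker ⟨x, hx⟩
    rw [(Submodule.isClosed_orthogonal _).submodule_topologicalClosure_eq] at hc
    rw [Submodule.inner_starProjection_left_eq_right,
      Submodule.eq_starProjection_of_mem_orthogonal hc ho]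
    exact (Submodule.mem_orthogonal' _ _).1 hq' _ (apply_mem_pRange Td _)
  rwa [Submodule.starProjection_apply_eq_zero_iff, Submodule.orthogonal_orthogonal] at hP

theorem pAccretive_of_inverse (h : IsMoorePenroseInverse T Td) (htop : Td.domain = ⊤)
    (hacc : PAccretive Td) : PAccretive T := by
  intro v
  obtain ⟨h1, h2, hv⟩ := h.tdt v
  have hn : (v : H) - Td ⟨T v, h1⟩ ∈ pKer T := by
    refine mem_pKer.2 ⟨Submodule.sub_mem _ v.2 h2, ?_⟩
    have h3 := T.map_sub v ⟨_, h2⟩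
    rwa [hv, sub_self] at h3
  have h0 := (Submodule.mem_orthogonal' _ _).1 (h.pKer_le_orthogonal_pRange htop hacc hn) _
    (apply_mem_pRange T v)
  rw [inner_sub_left, sub_eq_zero] at h0
  rw [h0, ← inner_conj_symm, Complex.conj_re]
  exact hacc ⟨T v, h1⟩

theorem mAccretive_of_inverse (h : IsMoorePenroseInverse T Td)
    (hclosed : IsClosed (T.graph : Set (H × H))) (hdense : Dense (T.domain : Set H))
    (htop : Td.domain = ⊤) (hacc : PAccretive Td) : MAccretive T := by
  refine ⟨h.pAccretive_of_inverse htop hacc, hdense, hclosed, fun μ hμ y => ?_⟩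
  obtain ⟨S, hS⟩ := exists_clm_of_isClosed_graph h.closed' htop
  have hSacc : CAccretive S := fun x => by
    rw [← hS ⟨x, htop ▸ trivial⟩]
    exact hacc ⟨x, htop ▸ trivial⟩
  obtain ⟨w, hw⟩ := hSacc.exists_add_smul_eq hμ.le y
  obtain ⟨h1, -, ho⟩ := h.proj_range ⟨w, htop ▸ trivial⟩
  obtain ⟨hq, hq0⟩ := mem_pKer.1 (h.orthogonal_pRange_le_pKer hclosed hdense hacc ho)
  refine ⟨⟨_, h1⟩ + (μ : ℂ)⁻¹ • ⟨_, hq⟩, ?_⟩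
  have hμ' : (μ : ℂ) ≠ 0 := Complex.ofReal_ne_zero.2 hμ.ne'
  rw [LinearPMap.map_add, LinearPMap.map_smul, hq0, smul_zero, add_zero, Submodule.coe_add,
    Submodule.coe_smul, smul_add, smul_inv_smul₀ hμ', ← hw, ← hS ⟨w, htop ▸ trivial⟩]
  dsimp only
  abel

end IsMoorePenroseInverse

theorem stmt_5 (T Td : H →ₗ.[ℂ] H) (hclosed : IsClosed (T.graph : Set (H × H)))
    (hdense : Dense (T.domain : Set H)) (hTd : IsMoorePenroseInverse T Td) :
    (MAccretive T ∧ IsClosed ((pRange T : Set H))) ↔ (BoundedPMap Td ∧ PAccretive Td) := by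
  constructor
  · rintro ⟨hT, hR⟩
    exact ⟨hTd.boundedPMap hR, hTd.pAccretive hT⟩
  · rintro ⟨hb, hacc⟩
    have htop := hb.domain_eq_top hTd.closed' hTd.dense'
    exact ⟨hTd.mAccretive_of_inverse hclosed hdense htop hacc, hTd.isClosed_pRange htop⟩
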